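/- Let $A=(Q,\Sigma,\delta,\rho)$ be a reversible Mealy automaton: $Q,\Sigma$ are nonempty finite sets, $\delta_i\colon Q\to Q$ ($i\in\Sigma$) are permutations and $\rho_x\colon\Sigma\to\Sigma$ ($x\in Q$) are maps. Extend $\delta_i$ to $Q^*$ by sending the empty word to itself and $\delta_i(xu)=\delta_i(x)\,\delta_{\rho_x(i)}(u)$, and put $\delta_{s_1\cdots s_n}=\delta_{s_n}\circ\cdots\circ\delta_{s_1}$. The component of a word $u\in Q^n$ is its orbit $\{\delta_s(u): s\in\Sigma^*\}\subseteq Q^n$. The orbit tree $\mathfrak{o}(A)$ is the rooted tree whose vertices are the components of words of $Q^*$, with root the component of the empty word, and whose edges $e$ go from the component $\top(e)$ of $u$ to the component $\bot(e)$ of $ux$, for $u\in Q^*$ and $x\in Q$; the label of $e$ is $\#\bot(e)/\#\top(e)$. An edge $f$ is a legitimate child of an edge $e$ if $\bot(e)=\top(f)$ and every word of $\bot(f)$ has some word of $\bot(e)$ as a suffix. Let $e$ be an edge of $\mathfrak{o}(A)$. If $e$ has at least one legitimate child, then the label of $e$ is equal to the sum of the labels of the legitimate children of $e$. Moreover, $e$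 has at least one legitimate child if and only if $e$ starts at the root or $e$ is itself a legitimate child of its parent edge. -/

import Mathlib

/-- A Mealy automaton with stateset `Q` and alphabet `S`. -/
structure MealyAutomaton (Q S : Type*) where
  /-- The transition functions `δ_i : Q → Q`. -/
  δ : S → Q → Q
  /-- The production functions `ρ_x : S → S`. -/
  ρ : Q → S → S

namespace MealyAutomaton

variable {Q S : Type*}

/-- Each letter acts on the stateset by a permutation. -/
def Reversible (A : MealyAutomaton Q S) : Prop :=
  ∀ i : S, Function.Bijective (A.δ i)

/-- The map `δ_i : Q* → Q*` induced by a letter: `δ_i(x·u) = δ_i(x) · δ_{ρ_x(i)}(u)`. -/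
def deltaLetter (A : MealyAutomaton Q S) : S → List Q → List Q
  | _, [] => []
  | i, x :: u => A.δ i x :: A.deltaLetter (A.ρ x i) u

/-- The map `δ_s : Q* → Q*` induced by a word: `δ_{s₁⋯s_n} = δ_{s_n} ∘ ⋯ ∘ δ_{s₁}`. -/
def deltaWord (A : MealyAutomaton Q S) : List S → List Q → List Q
  | [], u => u
  | i :: s, u => A.deltaWord s (A.deltaLetter i u)

/-- For a word `u` of length `n`, the connected component of `u` in the `n`-th power of a
reversible automaton `A`, that is, the orbit of `u` under the maps `δ_s`. The maps `δ_s` preserve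
length, so this is a set of words of length `n`. -/
def component (A : MealyAutomaton Q S) (u : List Q) : Set (List Q) :=
  {v | ∃ s : List S, A.deltaWord s u = v}

/-- The edges of the orbit tree: the pairs (component of `u`, component of `u·x`). -/
@[ext]
structure Edge (A : MealyAutomaton Q S) where
  /-- The upper endpoint `⊤(e)`. -/
  top : Set (List Q)
  /-- The lower endpoint `⊥(e)`. -/
  bot : Set (List Q)
  exists_word : ∃ (u : List Q) (x : Q), top = A.component u ∧ bot = A.component (u ++ [x])

namespace Edge

variable {A : MealyAutomaton Q S}

/-- The label `#⊥(e) / #⊤(e)`, as an exact quotient. -/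
noncomputable def label (e : A.Edge) : ℚ :=
  (e.bot.ncard : ℚ) / (e.top.ncard : ℚ)

/-- The edge starts at the root of the orbit tree (the component of the empty word). -/
def StartsAtRoot (e : A.Edge) : Prop :=
  e.top = A.component []

/-- `e` is liftable to `f`: every word of `⊥(e)` has some word of `⊥(f)` as a suffix. -/
def LiftableTo (e f : A.Edge) : Prop :=
  ∀ v ∈ e.bot, ∃ w ∈ f.bot, w <:+ v

/-- `f` is a legitimate child of `e`. -/
def IsLegitimateChild (f e : A.Edge) : Prop :=
  e.bot = f.top ∧ f.LiftableTo e

end Edge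

end MealyAutomaton

namespace MealyAutomaton

variable {Q S : Type*} {A : MealyAutomaton Q S}

@[simp]
theorem length_deltaLetter (i : S) (u : List Q) : (A.deltaLetter i u).length = u.length := by
  induction u generalizing i with
  | nil => rfl
  | cons x u ih => simp [deltaLetter, ih]

@[simp]
theorem length_deltaWord (s : List S) (u : List Q) : (A.deltaWord s u).length = u.length := by
  induction s generalizing u with
  | nil => rfl
  | cons i s ih => simp [deltaWord, ih]

theorem deltaWord_append (s t : List S) (u : List Q) :
    A.deltaWord (s ++ t) u = A.deltaWord t (A.deltaWord s u) := by
  induction s generalizing u with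
  | nil => rfl
  | cons i s ih => simp [deltaWord, ih]

theorem deltaLetter_injective (hA : A.Reversible) (i : S) :
    Function.Injective (A.deltaLetter i) := by
  intro u
  induction u generalizing i with
  | nil =>
    intro v h
    cases v with
    | nil => rfl
    | cons y v => simp [deltaLetter] at h
  | cons x u ih =>
    intro v h
    cases v with
    | nil => simp [deltaLetter] at h
    | cons y v =>
      simp only [deltaLetter, List.cons.injEq] at h
      obtain rfl := (hA i).1 h.1
      rw [ih _ h.2]

theorem deltaWord_injective (hA : A.Reversible) (s : List S) :
    Function.Injective (A.deltaWord s) := by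
  induction s with
  | nil => exact fun _ _ h => h
  | cons i s ih => exact fun _ _ h => deltaLetter_injective hA i (ih h)

theorem exists_deltaLetter_append_singleton (i : S) (u : List Q) :
    ∃ g : Q → Q, ∀ y, A.deltaLetter i (u ++ [y]) = A.deltaLetter i u ++ [g y] := by
  induction u generalizing i with
  | nil => exact ⟨A.δ i, fun y => rfl⟩
  | cons x u ih =>
    obtain ⟨g, hg⟩ := ih (A.ρ x i)
    exact ⟨g, fun y => by simp [deltaLetter, hg]⟩

theorem exists_deltaWord_append_singleton (s : List S) (u : List Q) :
    ∃ g : Q → Q, ∀ y, A.deltaWord s (u ++ [y]) = A.deltaWord s u ++ [g y] := by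
  induction s generalizing u with
  | nil => exact ⟨id, fun y => rfl⟩
  | cons i s ih =>
    obtain ⟨g, hg⟩ := exists_deltaLetter_append_singleton (A := A) i u
    obtain ⟨k, hk⟩ := ih (A.deltaLetter i u)
    exact ⟨k ∘ g, fun y => by simp [deltaWord, hg, hk]⟩

theorem exists_deltaWord_cons (s : List S) (z : Q) (t : List Q) :
    ∃ (z' : Q) (s' : List S), A.deltaWord s (z :: t) = z' :: A.deltaWord s' t := by
  induction s generalizing z t with
  | nil => exact ⟨z, [], rfl⟩
  | cons i s ih =>
    obtain ⟨z', s', h⟩ := ih (A.δ i z) (A.deltaLetter (A.ρ z i) t)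
    exact ⟨z', A.ρ z i :: s', h⟩

theorem mem_component_self (u : List Q) : u ∈ A.component u := ⟨[], rfl⟩

theorem deltaWord_mem_component {u v : List Q} (h : v ∈ A.component u) (s : List S) :
    A.deltaWord s v ∈ A.component u := by
  obtain ⟨r, rfl⟩ := h
  exact ⟨r ++ s, deltaWord_append r s u⟩

theorem length_eq_of_mem_component {u v : List Q} (h : v ∈ A.component u) :
    v.length = u.length := by
  obtain ⟨s, rfl⟩ := h
  exact length_deltaWord s u

theorem component_finite [Finite Q] (u : List Q) : (A.component u).Finite :=
  (List.finite_length_eq Q u.length).subset fun _ h => length_eq_of_mem_component h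

/-- The maps `δ_s` are injective on a finite component, so orbits are equivalence classes. -/
theorem component_eq_of_mem [Finite Q] (hA : A.Reversible) {u v : List Q}
    (h : v ∈ A.component u) : A.component v = A.component u := by
  obtain ⟨s, rfl⟩ := h
  have hsub : A.component (A.deltaWord s u) ⊆ A.component u := by
    rintro _ ⟨t, rfl⟩
    exact ⟨s ++ t, deltaWord_append s t u⟩
  have himage : A.deltaWord s '' A.component (A.deltaWord s u) = A.component (A.deltaWord s u) :=
    Set.eq_of_subset_of_ncard_le
      (Set.image_subset_iff.2 fun v hv => deltaWord_mem_component hv s)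
      (Set.ncard_image_of_injective _ (deltaWord_injective hA s)).ge (component_finite _)
  obtain ⟨w, hw, hwu⟩ := himage.ge (mem_component_self _)
  rw [deltaWord_injective hA s hwu] at hw
  refine hsub.antisymm ?_
  rintro _ ⟨t, rfl⟩
  exact deltaWord_mem_component hw t

namespace Edge

/-- The edge of the orbit tree from the component of `u` to the component of `u·x`. -/
def ofWord (A : MealyAutomaton Q S) (u : List Q) (x : Q) : A.Edge :=
  ⟨A.component u, A.component (u ++ [x]), u, x, rfl, rfl⟩

theorem mem_top_of_append_mem_bot (e : A.Edge) {w : List Q} {y : Q}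
    (h : w ++ [y] ∈ e.bot) : w ∈ e.top := by
  obtain ⟨u, x, ht, hb⟩ := e.exists_word
  rw [hb] at h
  obtain ⟨s, hs⟩ := h
  obtain ⟨g, hg⟩ := exists_deltaWord_append_singleton (A := A) s u
  rw [hg] at hs
  rw [ht]
  exact ⟨s, (List.append_inj' hs rfl).1⟩

theorem exists_append_mem_bot (e : A.Edge) {w : List Q} (h : w ∈ e.top) :
    ∃ y, w ++ [y] ∈ e.bot := by
  obtain ⟨u, x, ht, hb⟩ := e.exists_word
  rw [ht] at h
  obtain ⟨s, rfl⟩ := h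
  obtain ⟨g, hg⟩ := exists_deltaWord_append_singleton (A := A) s u
  exact ⟨g x, by rw [hb, ← hg]; exact ⟨s, rfl⟩⟩

theorem top_eq_component [Finite Q] (hA : A.Reversible) (e : A.Edge) {w : List Q}
    (h : w ∈ e.top) : e.top = A.component w := by
  obtain ⟨u, x, ht, hb⟩ := e.exists_word
  rw [ht] at h ⊢
  exact (component_eq_of_mem hA h).symm

theorem bot_eq_component [Finite Q] (hA : A.Reversible) (e : A.Edge) {w : List Q}
    (h : w ∈ e.bot) : e.bot = A.component w := by
  obtain ⟨u, x, ht, hb⟩ := e.exists_word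
  rw [hb] at h ⊢
  exact (component_eq_of_mem hA h).symm

theorem exists_append_mem (e : A.Edge) : ∃ (u : List Q) (x : Q), u ++ [x] ∈ e.bot := by
  obtain ⟨u, x, ht, hb⟩ := e.exists_word
  exact ⟨u, x, hb ▸ mem_component_self _⟩

theorem exists_cons_mem (e : A.Edge) : ∃ (z : Q) (t : List Q), z :: t ∈ e.bot := by
  obtain ⟨u, x, h⟩ := e.exists_append_mem
  cases u with
  | nil => exact ⟨x, [], h⟩
  | cons z t => exact ⟨z, t ++ [x], h⟩

theorem eq_ofWord [Finite Q] (hA : A.Reversible) (e : A.Edge) {w : List Q} {y : Q}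
    (h : w ++ [y] ∈ e.bot) : e = ofWord A w y :=
  Edge.ext (e.top_eq_component hA (e.mem_top_of_append_mem_bot h)) (e.bot_eq_component hA h)

theorem ncard_fiber_le [Finite Q] (hA : A.Reversible) (e : A.Edge) (w : List Q) (s : List S) :
    {y | w ++ [y] ∈ e.bot}.ncard ≤ {y | A.deltaWord s w ++ [y] ∈ e.bot}.ncard := by
  obtain ⟨g, hg⟩ := exists_deltaWord_append_singleton (A := A) s w
  refine Set.ncard_le_ncard_of_injOn g ?_ ?_ (Set.toFinite _)
  · intro y hy
    rw [Set.mem_ofPred_eq, e.bot_eq_component hA hy, ← hg]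
    exact ⟨s, rfl⟩
  · intro y _ y' _ hyy
    have := deltaWord_injective hA s (a₁ := w ++ [y]) (a₂ := w ++ [y']) (by rw [hg, hg, hyy])
    simpa using this

theorem ncard_fiber_eq [Finite Q] (hA : A.Reversible) (e : A.Edge) {v w : List Q}
    (hv : v ∈ e.top) (hw : w ∈ e.top) :
    {y | v ++ [y] ∈ e.bot}.ncard = {y | w ++ [y] ∈ e.bot}.ncard := by
  have key : ∀ {v w : List Q}, v ∈ e.top → w ∈ e.top →
      {y | v ++ [y] ∈ e.bot}.ncard ≤ {y | w ++ [y] ∈ e.bot}.ncard := by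
    intro v w hv hw
    rw [e.top_eq_component hA hv] at hw
    obtain ⟨s, rfl⟩ := hw
    exact e.ncard_fiber_le hA v s
  exact (key hv hw).antisymm (key hw hv)

theorem top_finite [Finite Q] (e : A.Edge) : e.top.Finite := by
  obtain ⟨u, x, ht, hb⟩ := e.exists_word
  exact ht ▸ component_finite u

theorem bot_finite [Finite Q] (e : A.Edge) : e.bot.Finite := by
  obtain ⟨u, x, ht, hb⟩ := e.exists_word
  exact hb ▸ component_finite _

theorem exists_eq_append (e : A.Edge) {v : List Q} (hv : v ∈ e.bot) :
    ∃ (u : List Q) (x : Q), v = u ++ [x] := by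
  obtain ⟨u, x, ht, hb⟩ := e.exists_word
  rw [hb] at hv
  have hl := length_eq_of_mem_component hv
  have hne : v ≠ [] := by
    rintro rfl
    simp at hl
  exact ⟨_, _, (List.dropLast_append_getLast hne).symm⟩

theorem ncard_bot [Finite Q] (hA : A.Reversible) (e : A.Edge) {w : List Q} (hw : w ∈ e.top) :
    e.bot.ncard = e.top.ncard * {y | w ++ [y] ∈ e.bot}.ncard := by
  classical
  have hmaps : ∀ v ∈ e.bot_finite.toFinset, v.dropLast ∈ e.top_finite.toFinset := by
    intro v hv
    rw [Set.Finite.mem_toFinset] at hv ⊢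
    obtain ⟨u, x, rfl⟩ := e.exists_eq_append hv
    rw [List.dropLast_concat]
    exact e.mem_top_of_append_mem_bot hv
  rw [Set.ncard_eq_toFinset_card _ e.bot_finite, Set.ncard_eq_toFinset_card _ e.top_finite,
    Finset.card_eq_sum_card_fiberwise hmaps]
  refine Finset.sum_const_nat fun v hv => ?_
  rw [e.ncard_fiber_eq hA hw ((Set.Finite.mem_toFinset _).1 hv), ← Set.ncard_coe_finset,
    ← Set.ncard_image_of_injective {y | v ++ [y] ∈ e.bot} (f := fun y => v ++ [y])
      fun y y' h => by simpa using h]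
  congr 1
  ext u
  simp only [Finset.coe_filter, Set.Finite.mem_toFinset, Set.mem_ofPred_eq, Set.mem_image]
  constructor
  · rintro ⟨hu, rfl⟩
    obtain ⟨u, x, rfl⟩ := e.exists_eq_append hu
    exact ⟨x, by simpa using hu, by simp⟩
  · rintro ⟨y, hy, rfl⟩
    exact ⟨hy, by simp⟩

/-- The label of an edge counts the one-letter extensions of any given word of `⊤(e)`. -/
theorem label_eq_ncard [Finite Q] (hA : A.Reversible) (e : A.Edge) {w : List Q}
    (hw : w ∈ e.top) : e.label = ({y | w ++ [y] ∈ e.bot}.ncard : ℚ) := by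
  have hpos : (e.top.ncard : ℚ) ≠ 0 :=
    Nat.cast_ne_zero.2 (Set.ncard_pos e.top_finite |>.2 ⟨w, hw⟩).ne'
  rw [label, e.ncard_bot hA hw, Nat.cast_mul, mul_div_cancel_left₀ _ hpos]

theorem isLegitimateChild_iff [Finite Q] (hA : A.Reversible) {e f : A.Edge}
    (hfe : e.bot = f.top) {z : Q} {t : List Q} {y : Q} (h : z :: t ++ [y] ∈ f.bot) :
    f.IsLegitimateChild e ↔ t ++ [y] ∈ e.bot := by
  constructor
  · rintro ⟨-, hf⟩
    obtain ⟨w, hw, hsuf⟩ := hf _ h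
    have hzt : z :: t ∈ e.bot := hfe ▸ f.mem_top_of_append_mem_bot h
    rw [e.bot_eq_component hA hzt] at hw
    have hl := length_eq_of_mem_component hw
    rw [List.cons_append, List.suffix_cons_iff] at hsuf
    rcases hsuf with rfl | hsuf
    · simp at hl
    · rw [← hsuf.eq_of_length (by simpa using hl), e.bot_eq_component hA hzt]
      exact hw
  · intro ht
    refine ⟨hfe, fun v hv => ?_⟩
    rw [f.bot_eq_component hA h] at hv
    obtain ⟨s, rfl⟩ := hv
    obtain ⟨z', s', hs⟩ := exists_deltaWord_cons (A := A) s z (t ++ [y])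
    refine ⟨A.deltaWord s' (t ++ [y]), ?_, ?_⟩
    · rw [e.bot_eq_component hA ht]
      exact ⟨s', rfl⟩
    · rw [List.cons_append, hs]
      exact List.suffix_cons _ _

theorem ofWord_isLegitimateChild_iff [Finite Q] (hA : A.Reversible) {e : A.Edge} {z : Q}
    {t : List Q} (h : z :: t ∈ e.bot) (y : Q) :
    (ofWord A (z :: t) y).IsLegitimateChild e ↔ t ++ [y] ∈ e.bot :=
  isLegitimateChild_iff hA (e.bot_eq_component hA h) (mem_component_self _)

theorem setOf_isLegitimateChild [Finite Q] (hA : A.Reversible) {e : A.Edge} {z : Q}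
    {t : List Q} (h : z :: t ∈ e.bot) :
    {f : A.Edge | f.IsLegitimateChild e} = ofWord A (z :: t) '' {y | t ++ [y] ∈ e.bot} := by
  ext f
  constructor
  · intro hf
    obtain ⟨y, hy⟩ := f.exists_append_mem_bot (hf.1 ▸ h)
    exact ⟨y, (isLegitimateChild_iff hA hf.1 hy).1 hf, (f.eq_ofWord hA hy).symm⟩
  · rintro ⟨y, hy, rfl⟩
    exact (ofWord_isLegitimateChild_iff hA h y).2 hy

theorem exists_isLegitimateChild_iff [Finite Q] (hA : A.Reversible) {e : A.Edge} {z : Q}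
    {t : List Q} (h : z :: t ∈ e.bot) :
    (∃ f : A.Edge, f.IsLegitimateChild e) ↔ t ∈ e.top := by
  change {f : A.Edge | f.IsLegitimateChild e}.Nonempty ↔ _
  rw [setOf_isLegitimateChild hA h, Set.image_nonempty]
  exact ⟨fun ⟨_, hy⟩ => e.mem_top_of_append_mem_bot hy, e.exists_append_mem_bot⟩

theorem startsAtRoot_or_isLegitimateChild_iff [Finite Q] (hA : A.Reversible) {e : A.Edge}
    {z : Q} {t : List Q} (h : z :: t ∈ e.bot) :
    (e.StartsAtRoot ∨ ∃ p : A.Edge, e.IsLegitimateChild p) ↔ t ∈ e.top := by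
  rcases List.eq_nil_or_concat' t with rfl | ⟨t, x, rfl⟩
  · have htop : ([] : List Q) ∈ e.top := e.mem_top_of_append_mem_bot (y := z) h
    exact iff_of_true (Or.inl (e.top_eq_component hA htop)) htop
  · have htop : z :: t ∈ e.top := e.mem_top_of_append_mem_bot (y := x) h
    constructor
    · rintro (hroot | ⟨p, hp⟩)
      · rw [hroot] at htop
        simpa using length_eq_of_mem_component htop
      · rw [← hp.1]
        exact (isLegitimateChild_iff hA hp.1 h).1 hp
    · intro ht
      obtain ⟨u, x', hu⟩ : ∃ u x', z :: t = u ++ [x'] :=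
        ⟨_, _, (List.dropLast_append_getLast (List.cons_ne_nil z t)).symm⟩
      have hp : (ofWord A u x').bot = e.top := by
        rw [e.top_eq_component hA htop, hu, ofWord]
      exact Or.inr ⟨ofWord A u x', (isLegitimateChild_iff hA hp h).2 (hp ▸ ht)⟩

theorem label_eq_finsum_label [Finite Q] (hA : A.Reversible) {e : A.Edge}
    (he : ∃ f : A.Edge, f.IsLegitimateChild e) :
    e.label = ∑ᶠ f ∈ {f : A.Edge | f.IsLegitimateChild e}, f.label := by
  classical
  obtain ⟨z, t, h⟩ := e.exists_cons_mem
  have ht := (exists_isLegitimateChild_iff hA h).1 he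
  have hfin : {y | t ++ [y] ∈ e.bot}.Finite := Set.toFinite _
  have hset : {f : A.Edge | f.IsLegitimateChild e} =
      ((hfin.toFinset.image (ofWord A (z :: t)) : Finset A.Edge) : Set A.Edge) := by
    rw [setOf_isLegitimateChild hA h]
    simp
  rw [hset, finsum_mem_coe_finset, e.label_eq_ncard hA ht, Set.ncard_eq_toFinset_card _ hfin,
    Finset.card_eq_sum_card_image (ofWord A (z :: t)), Nat.cast_sum]
  refine Finset.sum_congr rfl fun f hf => ?_
  have hf' : f.IsLegitimateChild e := by
    change f ∈ {f : A.Edge | f.IsLegitimateChild e}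
    rw [hset]
    exact hf
  rw [f.label_eq_ncard hA (hf'.1 ▸ h), ← Set.ncard_coe_finset]
  congr 2
  ext y
  simp only [Finset.coe_filter, Set.Finite.mem_toFinset, Set.mem_ofPred_eq]
  constructor
  · rintro ⟨-, rfl⟩
    exact mem_component_self _
  · intro hy
    exact ⟨(isLegitimateChild_iff hA hf'.1 hy).1 hf', (f.eq_ofWord hA hy).symm⟩

end Edge

end MealyAutomaton

theorem statement6 {Q S : Type*} [Finite Q] [Nonempty Q] [Finite S] [Nonempty S]
    (A : MealyAutomaton Q S) (hA : A.Reversible) (e : A.Edge) :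
    ((∃ f : A.Edge, f.IsLegitimateChild e) →
      e.label = ∑ᶠ f ∈ {f : A.Edge | f.IsLegitimateChild e}, f.label) ∧
    ((∃ f : A.Edge, f.IsLegitimateChild e) ↔
      e.StartsAtRoot ∨ ∃ p : A.Edge, e.IsLegitimateChild p) := by
  obtain ⟨z, t, h⟩ := e.exists_cons_mem
  exact ⟨MealyAutomaton.Edge.label_eq_finsum_label hA,
    (MealyAutomaton.Edge.exists_isLegitimateChild_iff hA h).trans
      (MealyAutomaton.Edge.startsAtRoot_or_isLegitimateChild_iff hA h).symm⟩
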